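/- arXiv:1902.04736 — 2 statements merged into one kernel-verified Lean document; each statement's English description precedes it below -/
import Mathlib

section
/- Let q be a prime power and n a positive integer such that n does not divide q − 1. Then 4·Ω_q(x^n − 1) ≤ 3n. -/
open Polynomial

/-- The number of distinct monic irreducible polynomials over `F` dividing `X^n - 1`. -/
noncomputable def OmegaQ (F : Type*) [Field F] (n : ℕ) : ℕ :=
  {g : F[X] | g.Monic ∧ Irreducible g ∧ g ∣ X ^ n - 1}.ncard

/-- A finite set of pairwise distinct monic irreducible divisors of a nonzero polynomial has
total degree at most the degree of that polynomial. -/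
theorem sum_natDegree_le_of_monic_irreducible_dvd {F : Type*} [Field F] {f : F[X]} (hf : f ≠ 0)
    (S : Finset F[X]) (hS : ∀ g ∈ S, g.Monic ∧ Irreducible g ∧ g ∣ f) :
    ∑ g ∈ S, g.natDegree ≤ f.natDegree := by
  have hdvd : ∏ g ∈ S, g ∣ f := by
    refine Finset.prod_dvd_of_coprime ?_ fun g hg => (hS g hg).2.2
    intro g hg h hh hne
    refine ((hS g hg).2.1.coprime_iff_not_dvd).2 fun hgh => hne ?_
    exact eq_of_monic_of_associated (hS g hg).1 (hS h hh).1
      ((hS g hg).2.1.associated_of_dvd (hS h hh).2.1 hgh)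
  rw [← natDegree_prod_of_monic S _ fun g hg => (hS g hg).1]
  exact natDegree_le_of_dvd hdvd hf

/-- The number of `n`-th roots of unity in a domain divides `n`. -/
theorem card_rootsOfUnity_dvd (R : Type*) [CommRing R] [IsDomain R] (n : ℕ) [NeZero n] :
    Nat.card (rootsOfUnity n R) ∣ n := by
  rw [← IsCyclic.exponent_eq_card]
  refine Monoid.exponent_dvd_of_forall_pow_eq_one fun x => ?_
  exact Subtype.ext x.2

/-- If `n` does not divide the order of `Fˣ`, at most half of the `n`-th roots of unity
lie in `F`. -/
theorem two_mul_card_rootsOfUnity_le (F : Type*) [Field F] [Fintype F] (n : ℕ) [NeZero n]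
    (h : ¬ n ∣ Fintype.card F - 1) : 2 * Nat.card (rootsOfUnity n F) ≤ n := by
  obtain ⟨k, hk⟩ := card_rootsOfUnity_dvd F n
  have hq : Nat.card (rootsOfUnity n F) ∣ Fintype.card F - 1 := by
    rw [← Nat.card_eq_fintype_card, ← Nat.card_units]
    exact Subgroup.card_subgroup_dvd_card _
  have hn : n ≠ 0 := NeZero.ne n
  generalize Nat.card (rootsOfUnity n F) = d at hk hq
  have hk2 : 2 ≤ k := by
    by_contra! hlt
    interval_cases k
    · exact hn (by simpa using hk)
    · exact h (by rwa [hk, mul_one])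
  calc 2 * d ≤ k * d := Nat.mul_le_mul_right _ hk2
    _ = n := by rw [hk, mul_comm]

/-- Distinct monic linear divisors of `X ^ n - 1` correspond to `n`-th roots of unity. -/
theorem card_filter_natDegree_eq_one_le {F : Type*} [Field F] (n : ℕ) [NeZero n]
    (S : Finset F[X]) (hS : ∀ g ∈ S, g.Monic ∧ Irreducible g ∧ g ∣ X ^ n - 1) :
    (S.filter fun g => g.natDegree = 1).card ≤ Nat.card (rootsOfUnity n F) := by
  classical
  have : Fintype (rootsOfUnity n F) := Fintype.ofFinite _
  rw [Nat.card_eq_fintype_card, ← Finset.card_univ]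
  refine Finset.card_le_card_of_surjOn
    (fun ζ : rootsOfUnity n F => (X - C ((ζ : Fˣ) : F) : F[X])) ?_
  intro g hg
  obtain ⟨hgS, hdeg⟩ := Finset.mem_filter.1 (Finset.mem_coe.1 hg)
  obtain ⟨hm, -, hd⟩ := hS g hgS
  have hform : g = X - C (-g.coeff 0) := by
    conv_lhs => rw [hm.eq_X_add_C hdeg]
    simp
  have hroot : (-g.coeff 0) ^ n = 1 := by
    rw [hform, dvd_iff_isRoot] at hd
    simpa [sub_eq_zero] using hd
  exact ⟨rootsOfUnity.mkOfPowEq _ hroot, by simp, by simpa using hform.symm⟩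

theorem four_mul_OmegaQ_le (q n : ℕ) (hn : 0 < n) (hdvd : ¬ n ∣ q - 1)
    (F : Type) [Field F] [Fintype F] (hF : Fintype.card F = q) :
    4 * OmegaQ F n ≤ 3 * n := by
  subst hF
  have : NeZero n := ⟨hn.ne'⟩
  unfold OmegaQ
  set T := {g : F[X] | g.Monic ∧ Irreducible g ∧ g ∣ X ^ n - 1}
  by_cases hfin : T.Finite
  swap
  · simp [Set.Infinite.ncard hfin]
  rw [Set.ncard_eq_toFinset_card T hfin]
  have hS : ∀ g ∈ hfin.toFinset, g.Monic ∧ Irreducible g ∧ g ∣ X ^ n - 1 := fun g hg =>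
    hfin.mem_toFinset.1 hg
  have hsum := sum_natDegree_le_of_monic_irreducible_dvd (X_pow_sub_C_ne_zero hn 1) _ hS
  rw [natDegree_X_pow_sub_C] at hsum
  have hlin := card_filter_natDegree_eq_one_le n _ hS
  have hroots := two_mul_card_rootsOfUnity_le F n hdvd
  have hcount : 2 * hfin.toFinset.card ≤
      ∑ g ∈ hfin.toFinset, g.natDegree + (hfin.toFinset.filter fun g => g.natDegree = 1).card := by
    rw [Finset.card_filter, ← Finset.sum_add_distrib, mul_comm, ← smul_eq_mul]
    refine Finset.card_nsmul_le_sum _ _ _ fun g hg => ?_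
    have := (hS g hg).2.1.natDegree_pos
    split_ifs <;> omega
  omega
end

section
/- For every positive integer N not divisible by 7, 2^(ω(N)) < 8.31 · N^(1/5), where N^(1/5) denotes the real fifth root of N. -/
/-- If every element of `T` is at most `c` and every element of `S` outside `T` is at least `c`,
then `T` maximizes `∏ p ∈ S, c / p`; stated without division. -/
lemma pow_card_mul_prod_le_pow_card_mul_prod {S T : Finset ℕ} {c : ℕ}
    (hT : ∀ p ∈ T, p ≤ c) (hS : ∀ p ∈ S, p ∉ T → c ≤ p) :
    c ^ S.card * ∏ p ∈ T, p ≤ c ^ T.card * ∏ p ∈ S, p := by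
  have hlarge : c ^ (S \ T).card ≤ ∏ p ∈ S \ T, p :=
    Finset.pow_card_le_prod _ _ _ fun p hp =>
      hS p (Finset.mem_sdiff.1 hp).1 (Finset.mem_sdiff.1 hp).2
  have hsmall : ∏ p ∈ T \ S, p ≤ c ^ (T \ S).card :=
    Finset.prod_le_pow_card _ _ _ fun p hp => hT p (Finset.mem_sdiff.1 hp).1
  rw [← Finset.card_inter_add_card_sdiff S T, ← Finset.card_inter_add_card_sdiff T S,
    ← Finset.prod_inter_mul_prod_sdiff S T, ← Finset.prod_inter_mul_prod_sdiff T S,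
    Finset.inter_comm T S, pow_add, pow_add]
  calc c ^ (S ∩ T).card * c ^ (S \ T).card * ((∏ p ∈ S ∩ T, p) * ∏ p ∈ T \ S, p)
      ≤ c ^ (S ∩ T).card * (∏ p ∈ S \ T, p) * ((∏ p ∈ S ∩ T, p) * c ^ (T \ S).card) := by
        gcongr
    _ = _ := by ring

/-- The extremal case is the product of the ten primes below `32` other than `7`. -/
lemma thirtyTwo_pow_card_primeFactors_mul_le {N : ℕ} (hN : 0 < N) (h7 : ¬ 7 ∣ N) :
    32 ^ N.primeFactors.card * 28651498590 ≤ 32 ^ 10 * N := by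
  have h := pow_card_mul_prod_le_pow_card_mul_prod (S := N.primeFactors)
    (T := {2, 3, 5, 11, 13, 17, 19, 23, 29, 31}) (c := 32) (by decide) (by
      intro p hp hpT
      have hprime := Nat.prime_of_mem_primeFactors hp
      have hp7 : p ≠ 7 := fun h => h7 (h ▸ Nat.dvd_of_mem_primeFactors hp)
      by_contra! hlt
      interval_cases p <;> revert hprime hpT hp7 <;> decide)
  exact h.trans (Nat.mul_le_mul_left _ (Nat.le_of_dvd hN (Nat.prod_primeFactors_dvd N)))

theorem two_pow_omega_lt_of_seven_not_dvd (N : ℕ) (hN : 0 < N) (h7 : ¬ (7 ∣ N)) :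
    (2 : ℝ) ^ N.primeFactors.card < 8.31 * (N : ℝ) ^ ((1 : ℝ) / 5) := by
  have hN' : (0 : ℝ) < N := by exact_mod_cast hN
  have h : (32 : ℝ) ^ N.primeFactors.card * 28651498590 ≤ 32 ^ 10 * N := by
    exact_mod_cast thirtyTwo_pow_card_primeFactors_mul_le hN h7
  refine lt_of_pow_lt_pow_left₀ 5 (by positivity) ?_
  have hroot : ((N : ℝ) ^ ((1 : ℝ) / 5)) ^ 5 = N := by
    rw [← Real.rpow_natCast, ← Real.rpow_mul hN'.le]
    norm_num
  rw [mul_pow, hroot, pow_right_comm]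
  norm_num at h ⊢
  linarith
end
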